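/- Assume H(A), H(B), H(J), H(f) and (H_s). Let v be the unique solution of Problem P_hvi and assume v is Lipschitz continuous on [0,T] (i.e. v ∈ W^{1,∞}(0,T;V)); write v_j = v(t_j). Let {v_j^{hk}} be the unique solution of Problem P_opt^h. Then there exists a constant c > 0, independent of h, k and N, such that max_{1≤j≤N} ‖v_j − v_j^{hk}‖_V² ≤ c max_{1≤j≤N} inf_{w^h ∈ V^h} { k² + ‖v_j − w^h‖_V² + ‖γ v_j − γ w^h‖_X + |R_j(v_j − w^h)| } + c ‖u₀ − u₀^h‖_V², where R_j(w) = ⟨A v_j, w⟩ + ⟨B(Kv)(t_j), w⟩ − ⟨f_j, w⟩. -/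

import Mathlib

open Filter MeasureTheory Set

noncomputable def clarkeDeriv {Y : Type*} [NormedAddCommGroup Y] [NormedSpace ℝ Y]
    (φ : Y → ℝ) (y z : Y) : ℝ :=
  Filter.limsup (fun p : Y × ℝ => (φ (p.1 + p.2 • z) - φ p.1) / p.2)
    ((nhds y) ×ˢ (nhdsWithin 0 (Set.Ioi 0)))

def clarkeSubdiff {Y : Type*} [NormedAddCommGroup Y] [NormedSpace ℝ Y]
    (φ : Y → ℝ) (y : Y) : Set (Y →L[ℝ] ℝ) :=
  {ξ | ∀ z, ξ z ≤ clarkeDeriv φ y z}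

/-- The discrete integration operator `(K^k v)_j = k ∑_{i=1}^j v_i + u₀ʰ`. -/
noncomputable def Kk {W : Type*} [AddCommMonoid W] [Module ℝ W]
    (k : ℝ) (u0h : W) (v : ℕ → W) (j : ℕ) : W :=
  k • (∑ i ∈ Finset.Icc 1 j, v i) + u0h

/-- The functional `L(w) = ½⟨Aw,w⟩ + ⟨Bz − g, w⟩ + J(γz, γw)`. -/
noncomputable def Lfun {V X : Type*} [NormedAddCommGroup V] [NormedSpace ℝ V]
    [NormedAddCommGroup X] [NormedSpace ℝ X]
    (γ : V →L[ℝ] X) (A : V →L[ℝ] V →L[ℝ] ℝ) (B : V → V →L[ℝ] ℝ)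
    (J : X → X → ℝ) (z : V) (g : V →L[ℝ] ℝ) (w : V) : ℝ :=
  (1 / 2) * A w w + (B z - g) w + J (γ z) (γ w)

/-- Problem `P_incl^h`: the discrete operator-inclusion problem. -/
def SolIncl {V X : Type*} [NormedAddCommGroup V] [NormedSpace ℝ V]
    [NormedAddCommGroup X] [NormedSpace ℝ X]
    (γ : V →L[ℝ] X) (A : V →L[ℝ] V →L[ℝ] ℝ) (B : V → V →L[ℝ] ℝ)
    (J : X → X → ℝ) (f : ℝ → V →L[ℝ] ℝ)
    (Vh : Submodule ℝ V) (u0h : Vh) (k : ℝ) (N : ℕ) (v : ℕ → Vh) : Prop :=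
  ∀ j ∈ Finset.Icc 1 N,
    ∃ ζ ∈ clarkeSubdiff (J (γ ↑(Kk k u0h v (j - 1)))) (γ ↑(v j)),
      ∀ wh ∈ Vh,
        A ↑(v j) wh + B ↑(Kk k u0h v (j - 1)) wh + ζ (γ wh) = f ((j : ℝ) * k) wh

/-- Problem `P_opt^h`: `0 ∈ ∂(L_j|_{V^h})(v_j)` for `j = 1, …, N`. -/
def SolOpt {V X : Type*} [NormedAddCommGroup V] [NormedSpace ℝ V]
    [NormedAddCommGroup X] [NormedSpace ℝ X]
    (γ : V →L[ℝ] X) (A : V →L[ℝ] V →L[ℝ] ℝ) (B : V → V →L[ℝ] ℝ)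
    (J : X → X → ℝ) (f : ℝ → V →L[ℝ] ℝ)
    (Vh : Submodule ℝ V) (u0h : Vh) (k : ℝ) (N : ℕ) (v : ℕ → Vh) : Prop :=
  ∀ j ∈ Finset.Icc 1 N,
    (0 : Vh →L[ℝ] ℝ) ∈ clarkeSubdiff
      (fun x : Vh => Lfun γ A B J (↑(Kk k u0h v (j - 1))) (f ((j : ℝ) * k)) ↑x) (v j)

theorem tendsto_add_smul_clarke {Y : Type*} [NormedAddCommGroup Y] [NormedSpace ℝ Y] (y z : Y) :
    Tendsto (fun p : Y × ℝ => p.1 + p.2 • z) (nhds y ×ˢ nhdsWithin 0 (Ioi 0)) (nhds y) := by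
  have h1 : Tendsto (fun p : Y × ℝ => p.1) (nhds y ×ˢ nhdsWithin (0 : ℝ) (Ioi 0)) (nhds y) :=
    tendsto_fst
  have h2 : Tendsto (fun p : Y × ℝ => p.2) (nhds y ×ˢ nhdsWithin (0 : ℝ) (Ioi 0)) (nhds 0) :=
    tendsto_snd.mono_right nhdsWithin_le_nhds
  simpa using h1.add (h2.smul_const z)

theorem eventually_snd_pos_clarke {Y : Type*} [NormedAddCommGroup Y] (y : Y) :
    ∀ᶠ p : Y × ℝ in nhds y ×ˢ nhdsWithin 0 (Ioi 0), 0 < p.2 :=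
  tendsto_snd.eventually (eventually_mem_nhdsWithin (a := (0 : ℝ)) (s := Ioi 0))

theorem LocallyLipschitz.exists_abs_quotient_le {Y : Type*} [NormedAddCommGroup Y]
    [NormedSpace ℝ Y] {φ : Y → ℝ} (hφ : LocallyLipschitz φ) (y : Y) :
    ∃ K : ℝ, 0 ≤ K ∧ ∀ z, ∀ᶠ p : Y × ℝ in nhds y ×ˢ nhdsWithin 0 (Ioi 0),
      |(φ (p.1 + p.2 • z) - φ p.1) / p.2| ≤ K * ‖z‖ := by
  obtain ⟨K, t, ht, hK⟩ := hφ y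
  refine ⟨K, K.2, fun z => ?_⟩
  filter_upwards [tendsto_add_smul_clarke y z ht, tendsto_fst ht,
    eventually_snd_pos_clarke y] with p h1 h2 h3
  have h := hK.dist_le_mul _ h1 _ h2
  rw [Real.dist_eq, dist_eq_norm, add_sub_cancel_left, norm_smul, Real.norm_eq_abs,
    abs_of_pos h3] at h
  rw [abs_div, abs_of_pos h3, div_le_iff₀ h3]
  linarith

theorem clarkeDeriv_le_of_eventually {Y : Type*} [NormedAddCommGroup Y] [NormedSpace ℝ Y]
    {φ : Y → ℝ} {y z : Y} {a b : ℝ}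
    (hb : ∀ᶠ p : Y × ℝ in nhds y ×ˢ nhdsWithin 0 (Ioi 0),
      b ≤ (φ (p.1 + p.2 • z) - φ p.1) / p.2)
    (ha : ∀ᶠ p : Y × ℝ in nhds y ×ˢ nhdsWithin 0 (Ioi 0),
      (φ (p.1 + p.2 • z) - φ p.1) / p.2 ≤ a) :
    clarkeDeriv φ y z ≤ a :=
  limsup_le_of_le (IsBoundedUnder.isCoboundedUnder_le ⟨b, hb⟩) ha

namespace LocallyLipschitz

variable {Y : Type*} [NormedAddCommGroup Y] [NormedSpace ℝ Y] {φ : Y → ℝ}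

theorem eventually_quotient_lt (hφ : LocallyLipschitz φ) {y z : Y} {a : ℝ}
    (ha : clarkeDeriv φ y z < a) :
    ∀ᶠ p : Y × ℝ in nhds y ×ˢ nhdsWithin 0 (Ioi 0),
      (φ (p.1 + p.2 • z) - φ p.1) / p.2 < a := by
  obtain ⟨K, -, hK⟩ := hφ.exists_abs_quotient_le y
  exact eventually_lt_of_limsup_lt ha
    ⟨K * ‖z‖, (hK z).mono fun p hp => (abs_le.1 hp).2⟩

theorem clarkeDeriv_le (hφ : LocallyLipschitz φ) {y z : Y} {a : ℝ}
    (ha : ∀ᶠ p : Y × ℝ in nhds y ×ˢ nhdsWithin 0 (Ioi 0),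
      (φ (p.1 + p.2 • z) - φ p.1) / p.2 ≤ a) :
    clarkeDeriv φ y z ≤ a := by
  obtain ⟨K, -, hK⟩ := hφ.exists_abs_quotient_le y
  exact clarkeDeriv_le_of_eventually ((hK z).mono fun p hp => (abs_le.1 hp).1) ha

theorem exists_clarkeDeriv_le_mul_norm (hφ : LocallyLipschitz φ) (y : Y) :
    ∃ K : ℝ, 0 ≤ K ∧ ∀ z, clarkeDeriv φ y z ≤ K * ‖z‖ := by
  obtain ⟨K, hK0, hK⟩ := hφ.exists_abs_quotient_le y
  exact ⟨K, hK0, fun z => hφ.clarkeDeriv_le ((hK z).mono fun p hp => (abs_le.1 hp).2)⟩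

theorem clarkeDeriv_add_le (hφ : LocallyLipschitz φ) (y z₁ z₂ : Y) :
    clarkeDeriv φ y (z₁ + z₂) ≤ clarkeDeriv φ y z₁ + clarkeDeriv φ y z₂ := by
  refine le_of_forall_pos_le_add fun ε hε => ?_
  have h1 := hφ.eventually_quotient_lt (lt_add_of_pos_right (clarkeDeriv φ y z₁) (half_pos hε))
  have h2 := hφ.eventually_quotient_lt (lt_add_of_pos_right (clarkeDeriv φ y z₂) (half_pos hε))
  have h3 := ((tendsto_add_smul_clarke y z₂).prodMk
    (tendsto_snd (f := nhds y) (g := nhdsWithin (0 : ℝ) (Ioi 0)))).eventually h1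
  refine hφ.clarkeDeriv_le ?_
  filter_upwards [h2, h3] with p h2 h3
  have : p.1 + p.2 • (z₁ + z₂) = p.1 + p.2 • z₂ + p.2 • z₁ := by rw [smul_add]; abel
  rw [this]
  rw [sub_div] at h2 h3 ⊢
  linarith

theorem clarkeDeriv_zero (y : Y) : clarkeDeriv φ y 0 = 0 := by
  simp [clarkeDeriv]

theorem clarkeDeriv_smul_le (hφ : LocallyLipschitz φ) (y z : Y) {c : ℝ} (hc : 0 < c) :
    clarkeDeriv φ y (c • z) ≤ c * clarkeDeriv φ y z := by
  refine le_of_forall_pos_le_add fun ε hε => ?_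
  have h1 := hφ.eventually_quotient_lt
    (lt_add_of_pos_right (clarkeDeriv φ y z) (div_pos hε hc))
  have hmul : Tendsto (fun x : ℝ => c * x) (nhdsWithin 0 (Ioi 0)) (nhdsWithin 0 (Ioi 0)) := by
    refine tendsto_nhdsWithin_iff.2 ⟨?_, ?_⟩
    · have : Tendsto (fun x : ℝ => c * x) (nhds 0) (nhds (c * 0)) := by
        exact (continuous_const_mul c).tendsto 0
      rw [mul_zero] at this
      exact this.mono_left nhdsWithin_le_nhds
    · filter_upwards [self_mem_nhdsWithin] with x hx using mul_pos hc hx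
  have h2 := ((tendsto_fst (f := nhds y) (g := nhdsWithin (0 : ℝ) (Ioi 0))).prodMk
    (hmul.comp tendsto_snd)).eventually h1
  refine hφ.clarkeDeriv_le ?_
  filter_upwards [h2, eventually_snd_pos_clarke y] with p h2 h3
  simp only [Function.comp_apply] at h2
  rw [div_lt_iff₀ (mul_pos hc h3)] at h2
  rw [smul_smul, mul_comm p.2 c, div_le_iff₀ h3]
  refine h2.le.trans (le_of_eq ?_)
  field_simp

theorem clarkeDeriv_smul (hφ : LocallyLipschitz φ) (y z : Y) {c : ℝ} (hc : 0 < c) :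
    clarkeDeriv φ y (c • z) = c * clarkeDeriv φ y z := by
  refine le_antisymm (hφ.clarkeDeriv_smul_le y z hc) ?_
  have h := hφ.clarkeDeriv_smul_le y (c • z) (inv_pos.2 hc)
  rw [smul_smul, inv_mul_cancel₀ hc.ne', one_smul] at h
  rwa [← div_eq_inv_mul, le_div_iff₀ hc, mul_comm] at h

theorem mul_clarkeDeriv_le (hφ : LocallyLipschitz φ) (y z : Y) (c : ℝ) :
    c * clarkeDeriv φ y z ≤ clarkeDeriv φ y (c • z) := by
  rcases lt_trichotomy c 0 with hc | rfl | hc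
  · have h := hφ.clarkeDeriv_add_le y (c • z) ((-c) • z)
    rw [hφ.clarkeDeriv_smul y z (neg_pos.2 hc), ← add_smul, add_neg_cancel, zero_smul,
      clarkeDeriv_zero] at h
    linarith
  · simp [clarkeDeriv_zero]
  · exact (hφ.clarkeDeriv_smul y z hc).ge

theorem exists_mem_clarkeSubdiff_apply_eq (hφ : LocallyLipschitz φ) (y z : Y) :
    ∃ ξ ∈ clarkeSubdiff φ y, ξ z = clarkeDeriv φ y z := by
  have hdom : ∃ g : Y →ₗ[ℝ] ℝ, (∀ x, g x ≤ clarkeDeriv φ y x) ∧ g z = clarkeDeriv φ y z := by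
    by_cases hz : z = 0
    · obtain ⟨g, -, hg⟩ := exists_extension_of_le_sublinear (⊥ : Y →ₗ.[ℝ] ℝ) (clarkeDeriv φ y)
        (fun c hc x => hφ.clarkeDeriv_smul y x hc) (hφ.clarkeDeriv_add_le y)
        (by
          rintro ⟨x, hx⟩
          obtain rfl : x = 0 := (Submodule.mem_bot ℝ).1 hx
          have h0 : (⊥ : Y →ₗ.[ℝ] ℝ) ⟨0, hx⟩ = 0 := LinearPMap.map_zero _
          rw [h0, clarkeDeriv_zero])
      exact ⟨g, hg, by simp [hz, clarkeDeriv_zero]⟩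
    · obtain ⟨g, hg, hg'⟩ := exists_extension_of_le_sublinear
        (LinearPMap.mkSpanSingleton z (clarkeDeriv φ y z) hz) (clarkeDeriv φ y)
        (fun c hc x => hφ.clarkeDeriv_smul y x hc) (hφ.clarkeDeriv_add_le y)
        (by
          rintro ⟨x, hx⟩
          obtain ⟨c, rfl⟩ := Submodule.mem_span_singleton.1 hx
          exact (LinearPMap.mkSpanSingleton'_apply (σ := RingHom.id ℝ) z (clarkeDeriv φ y z) _ c
            hx).trans_le (hφ.mul_clarkeDeriv_le y z c))
      refine ⟨g, hg', ?_⟩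
      have h := hg ⟨z, Submodule.mem_span_singleton_self z⟩
      rwa [LinearPMap.mkSpanSingleton_apply] at h
  obtain ⟨g, hg, hgz⟩ := hdom
  obtain ⟨K, -, hK⟩ := hφ.exists_clarkeDeriv_le_mul_norm y
  refine ⟨g.mkContinuous K fun x => abs_le.2 ⟨?_, (hg x).trans (hK x)⟩, hg, hgz⟩
  have h := (hg (-x)).trans (hK (-x))
  rw [map_neg, norm_neg] at h
  linarith

theorem clarkeDeriv_le_mul_norm (hφ : LocallyLipschitz φ) {y : Y} {C : ℝ}
    (hC : ∀ ξ ∈ clarkeSubdiff φ y, ‖ξ‖ ≤ C) (z : Y) :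
    clarkeDeriv φ y z ≤ C * ‖z‖ := by
  obtain ⟨ξ, hξ, hξz⟩ := hφ.exists_mem_clarkeSubdiff_apply_eq y z
  rw [← hξz]
  exact (le_abs_self _).trans (ξ.le_of_opNorm_le (hC ξ hξ) z)

end LocallyLipschitz

theorem clarkeDeriv_Lfun_le {V X : Type*} [NormedAddCommGroup V] [NormedSpace ℝ V]
    [NormedAddCommGroup X] [NormedSpace ℝ X]
    (γ : V →L[ℝ] X) (A : V →L[ℝ] V →L[ℝ] ℝ) (hAsym : ∀ u v : V, A u v = A v u)
    (B : V → V →L[ℝ] ℝ) (J : X → X → ℝ) (hJ : ∀ w : X, LocallyLipschitz (J w))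
    (u : V) (g : V →L[ℝ] ℝ) (Vh : Submodule ℝ V) (y z : Vh) :
    clarkeDeriv (fun x : Vh => Lfun γ A B J u g ↑x) y z ≤
      A y z + (B u - g) z + clarkeDeriv (J (γ u)) (γ y) (γ z) := by
  set F : Filter (Vh × ℝ) := nhds y ×ˢ nhdsWithin 0 (Ioi 0) with hF
  have hquot : ∀ᶠ p : Vh × ℝ in F,
      (Lfun γ A B J u g ↑(p.1 + p.2 • z) - Lfun γ A B J u g ↑p.1) / p.2 =
        (A p.1 z + p.2 * (A z z / 2) + (B u - g) z) +
          (J (γ u) (γ p.1 + p.2 • γ z) - J (γ u) (γ p.1)) / p.2 := by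
    filter_upwards [eventually_snd_pos_clarke y] with p hp
    have hsym := hAsym z p.1
    simp only [Lfun, Submodule.coe_add, Submodule.coe_smul, map_add, map_smul,
      _root_.add_apply, _root_.smul_apply, smul_eq_mul, hsym]
    field_simp
    ring
  have hsmooth : Tendsto (fun p : Vh × ℝ => A p.1 z + p.2 * (A z z / 2) + (B u - g) z) F
      (nhds (A y z + (B u - g) z)) := by
    have hc : Continuous (fun p : Vh × ℝ => A p.1 z + p.2 * (A z z / 2) + (B u - g) z) := by
      fun_prop
    have h := (hc.tendsto (y, 0)).mono_left
      (show F ≤ nhds (y, 0) by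
        rw [nhds_prod_eq]; exact Filter.prod_mono le_rfl nhdsWithin_le_nhds)
    simpa using h
  have hmap : Tendsto (fun p : Vh × ℝ => (γ p.1, p.2)) F
      (nhds (γ y) ×ˢ nhdsWithin 0 (Ioi 0)) := by
    have hc : Continuous (fun x : Vh => γ x) := by fun_prop
    exact ((hc.tendsto y).comp tendsto_fst).prodMk tendsto_snd
  obtain ⟨K, -, hK⟩ := (hJ (γ u)).exists_abs_quotient_le (γ y)
  have hlow := hmap.eventually (hK (γ z))
  refine le_of_forall_pos_le_add fun ε hε => ?_
  have hup := hmap.eventually ((hJ (γ u)).eventually_quotient_lt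
    (lt_add_of_pos_right (clarkeDeriv (J (γ u)) (γ y) (γ z)) (half_pos hε)))
  refine clarkeDeriv_le_of_eventually (b := A y z + (B u - g) z - 1 - K * ‖γ z‖) ?_ ?_
  · filter_upwards [hquot, hlow, hsmooth.eventually (lt_mem_nhds (sub_one_lt _))] with p h1 h2 h3
    rw [h1]
    have := (abs_le.1 h2).1
    linarith
  · filter_upwards [hquot, hup,
      hsmooth.eventually (gt_mem_nhds (lt_add_of_pos_right _ (half_pos hε)))] with p h1 h2 h3
    rw [h1]
    linarith

theorem SolOpt.hvi {V X : Type*} [NormedAddCommGroup V] [NormedSpace ℝ V]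
    [NormedAddCommGroup X] [NormedSpace ℝ X]
    {γ : V →L[ℝ] X} {A : V →L[ℝ] V →L[ℝ] ℝ} (hAsym : ∀ u v : V, A u v = A v u)
    {B : V → V →L[ℝ] ℝ} {J : X → X → ℝ} (hJ : ∀ w : X, LocallyLipschitz (J w))
    {f : ℝ → V →L[ℝ] ℝ} {Vh : Submodule ℝ V} {u0h : Vh} {k : ℝ} {N : ℕ} {v : ℕ → Vh}
    (h : SolOpt γ A B J f Vh u0h k N v) {j : ℕ} (hj : j ∈ Finset.Icc 1 N) (z : Vh) :
    f (j * k) z ≤ A (v j) z + B (Kk k u0h v (j - 1) : Vh) z +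
      clarkeDeriv (J (γ (Kk k u0h v (j - 1) : Vh))) (γ (v j)) (γ z) := by
  have h1 := (h j hj z).trans (clarkeDeriv_Lfun_le γ A hAsym B J hJ _ _ Vh (v j) z)
  simp only [_root_.zero_apply, _root_.sub_apply] at h1
  linarith

theorem le_mul_pow_of_le_add_mul_sum {a : ℕ → ℝ} {G h : ℝ} (hh : 0 ≤ h) {N : ℕ}
    (ha : ∀ j ∈ Finset.Icc 1 N, a j ≤ G + h * ∑ i ∈ Finset.Icc 1 (j - 1), a i) :
    ∀ j ∈ Finset.Icc 1 N, a j ≤ G * (1 + h) ^ (j - 1) := by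
  have key : ∀ n < N, G + h * ∑ i ∈ Finset.Icc 1 n, a i ≤ G * (1 + h) ^ n := by
    intro n
    induction n with
    | zero => intro _; simp
    | succ n ih =>
      intro hn
      have h1 := ih (by omega)
      have h2 := ha (n + 1) (Finset.mem_Icc.2 ⟨by omega, by omega⟩)
      rw [Nat.add_sub_cancel] at h2
      rw [Finset.sum_Icc_succ_top (by omega), pow_succ]
      have h3 := mul_le_mul_of_nonneg_left (h2.trans h1) hh
      linarith
  intro j hj
  have hj' := Finset.mem_Icc.1 hj
  exact (ha j hj).trans (key (j - 1) (by omega))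

theorem le_mul_exp_of_le_add_mul_sum {a : ℕ → ℝ} {G h : ℝ} (hG : 0 ≤ G) (hh : 0 ≤ h) {N : ℕ}
    (ha : ∀ j ∈ Finset.Icc 1 N, a j ≤ G + h * ∑ i ∈ Finset.Icc 1 (j - 1), a i) :
    ∀ j ∈ Finset.Icc 1 N, a j ≤ G * Real.exp (N * h) := by
  intro j hj
  have hj' := Finset.mem_Icc.1 hj
  refine (le_mul_pow_of_le_add_mul_sum hh ha j hj).trans (mul_le_mul_of_nonneg_left ?_ hG)
  calc (1 + h) ^ (j - 1) ≤ (1 + h) ^ N := pow_le_pow_right₀ (by linarith) (by omega)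
    _ ≤ Real.exp h ^ N := by
      gcongr
      rw [add_comm]
      exact Real.add_one_le_exp h
    _ = Real.exp (N * h) := (Real.exp_nat_mul h N).symm

theorem sq_le_three_mul_add_sq {x a b c : ℝ} (hx : 0 ≤ x) (h : x ≤ a + b + c) :
    x ^ 2 ≤ 3 * (a ^ 2 + b ^ 2 + c ^ 2) := by
  have h1 : x ^ 2 ≤ (a + b + c) ^ 2 := pow_le_pow_left₀ hx h 2
  nlinarith [sq_nonneg (a - b), sq_nonneg (a - c), sq_nonneg (b - c)]

theorem sq_le_of_quadratic_bound {m L α β P Q S Γ e d δ g r : ℝ} (hm : 0 < m) (hL : 0 ≤ L)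
    (hP : 0 ≤ P) (hQ : 0 ≤ Q) (hS : 0 ≤ S) (hΓ : 0 ≤ Γ)
    (he : 0 ≤ e) (hδ : 0 ≤ δ) (hg : 0 ≤ g) (hr : 0 ≤ r) (hgd : g ≤ Γ * d)
    (h : m * e ^ 2 ≤ L * δ * (e + d) + r + α * e * d + β * δ * e + (P + Q * δ + S * e) * g) :
    e ^ 2 ≤ 2 / m * ((L + β) ^ 2 / m + (α + S * Γ) ^ 2 / m + (L + Q * Γ) + 1 + P) *
      (δ ^ 2 + d ^ 2 + g + r) := by
  set a := L + β with ha
  set b := α + S * Γ with hb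
  have h1 : S * e * g ≤ S * e * (Γ * d) := by gcongr
  have h2 : Q * δ * g ≤ Q * δ * (Γ * d) := by gcongr
  have h3 : e * (a * δ + b * d) ≤ m / 2 * e ^ 2 + (a ^ 2 / m * δ ^ 2 + b ^ 2 / m * d ^ 2) := by
    have h4 : m / 2 * e ^ 2 + (a ^ 2 / m * δ ^ 2 + b ^ 2 / m * d ^ 2) - e * (a * δ + b * d) =
        ((m * e - (a * δ + b * d)) ^ 2 + (a * δ - b * d) ^ 2) / (2 * m) := by
      field_simp
      ring
    have h5 : 0 ≤ ((m * e - (a * δ + b * d)) ^ 2 + (a * δ - b * d) ^ 2) / (2 * m) := by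
      positivity
    linarith
  have h6 : (L + Q * Γ) * (δ * d) ≤ (L + Q * Γ) * (δ ^ 2 + d ^ 2) := by
    gcongr
    nlinarith [sq_nonneg (δ - d), sq_nonneg δ, sq_nonneg d]
  have h7 : m / 2 * e ^ 2 ≤ a ^ 2 / m * δ ^ 2 + b ^ 2 / m * d ^ 2 +
      (L + Q * Γ) * (δ ^ 2 + d ^ 2) + r + P * g := by
    rw [ha, hb] at h3 ⊢
    linarith
  have hA : 0 ≤ a ^ 2 / m := by positivity
  have hB : 0 ≤ b ^ 2 / m := by positivity
  have hC : 0 ≤ L + Q * Γ := by positivity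
  have h8 : a ^ 2 / m * δ ^ 2 + b ^ 2 / m * d ^ 2 + (L + Q * Γ) * (δ ^ 2 + d ^ 2) + r + P * g ≤
      (a ^ 2 / m + b ^ 2 / m + (L + Q * Γ) + 1 + P) * (δ ^ 2 + d ^ 2 + g + r) := by
    have : 0 ≤ a ^ 2 / m * (d ^ 2 + g + r) + b ^ 2 / m * (δ ^ 2 + g + r) +
      (L + Q * Γ) * (g + r) + (δ ^ 2 + d ^ 2 + g) + P * (δ ^ 2 + d ^ 2 + r) := by positivity
    linarith
  have h9 : e ^ 2 = 2 / m * (m / 2 * e ^ 2) := by field_simp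
  rw [h9, mul_assoc (2 / m)]
  exact mul_le_mul_of_nonneg_left (h7.trans h8) (by positivity)

theorem LipschitzOnWith.norm_integral_sub_sum_le {V : Type*} [NormedAddCommGroup V]
    [NormedSpace ℝ V] [CompleteSpace V] {v : ℝ → V} {L : NNReal} {T k : ℝ} (hk : 0 ≤ k)
    (hv : LipschitzOnWith L v (Icc 0 T)) (n : ℕ) (hn : n * k ≤ T) :
    ‖(∫ s in (0 : ℝ)..n * k, v s) - k • ∑ i ∈ Finset.Icc 1 n, v (i * k)‖ ≤
      n * (L * k * k) := by
  induction n with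
  | zero => simp
  | succ n ih =>
    have h0 : 0 ≤ n * k := by positivity
    have h1 : n * k ≤ (n + 1 : ℕ) * k := by push_cast; linarith
    have hsub : ∀ {x y : ℝ}, 0 ≤ x → x ≤ y → y ≤ T → IntervalIntegrable v volume x y := by
      intro x y hx hxy hy
      refine ContinuousOn.intervalIntegrable (hv.continuousOn.mono ?_)
      rw [uIcc_of_le hxy]
      exact Icc_subset_Icc hx hy
    have hi1 := hsub le_rfl h0 (h1.trans hn)
    have hi2 := hsub h0 h1 hn
    have hlen : ((n + 1 : ℕ) : ℝ) * k - n * k = k := by push_cast; ring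
    have hstep : ‖∫ s in (n * k : ℝ)..(n + 1 : ℕ) * k, (v s - v ((n + 1 : ℕ) * k))‖ ≤
        L * k * k := by
      have := intervalIntegral.norm_integral_le_of_norm_le_const (C := L * k)
        (a := n * k) (b := (n + 1 : ℕ) * k) (f := fun s => v s - v ((n + 1 : ℕ) * k)) (by
          intro s hs
          rw [uIoc_of_le h1] at hs
          have h := hv.dist_le_mul s ⟨h0.trans hs.1.le, hs.2.trans hn⟩ _ ⟨h0.trans h1, hn⟩
          rw [dist_eq_norm, Real.dist_eq] at h
          refine h.trans ?_
          gcongr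
          rw [abs_le]
          constructor <;> linarith [hs.1, hs.2])
      rwa [hlen, abs_of_nonneg hk] at this
    rw [intervalIntegral.integral_sub hi2 intervalIntegrable_const,
      intervalIntegral.integral_const, hlen] at hstep
    rw [← intervalIntegral.integral_add_adjacent_intervals hi1 hi2,
      Finset.sum_Icc_succ_top (by omega), smul_add]
    have hsplit : ∀ a b c d : V, a + b - (c + d) = (a - c) + (b - d) := by intros; abel
    rw [hsplit]
    refine (norm_add_le _ _).trans ((add_le_add (ih (h1.trans hn)) hstep).trans (le_of_eq ?_))
    push_cast
    ring

theorem LipschitzOnWith.norm_integral_sub_Kk_le {V : Type*} [NormedAddCommGroup V]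
    [NormedSpace ℝ V] [CompleteSpace V] {v : ℝ → V} {L : NNReal} {T k M : ℝ} (hk : 0 ≤ k)
    (hv : LipschitzOnWith L v (Icc 0 T)) (hM : ∀ t ∈ Icc 0 T, ‖v t‖ ≤ M)
    (u₀ u₁ : V) (y : ℕ → V) {j : ℕ} (hj1 : 1 ≤ j) (hj : j * k ≤ T) :
    ‖((∫ s in (0 : ℝ)..j * k, v s) + u₀) - Kk k u₁ y (j - 1)‖ ≤
      (T * L + M) * k + k * ∑ i ∈ Finset.Icc 1 (j - 1), ‖v (i * k) - y i‖ + ‖u₀ - u₁‖ := by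
  obtain ⟨n, rfl⟩ : ∃ n, j = n + 1 := ⟨j - 1, by omega⟩
  rw [Nat.add_sub_cancel]
  have h0 : 0 ≤ n * k := by positivity
  have h1 : n * k ≤ (n + 1 : ℕ) * k := by push_cast; linarith
  have hsub : ∀ {x y : ℝ}, 0 ≤ x → x ≤ y → y ≤ T → IntervalIntegrable v volume x y := by
    intro x y hx hxy hy
    refine ContinuousOn.intervalIntegrable (hv.continuousOn.mono ?_)
    rw [uIcc_of_le hxy]
    exact Icc_subset_Icc hx hy
  have hi1 := hsub le_rfl h0 (h1.trans hj)
  have hi2 := hsub h0 h1 hj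
  have hlen : ((n + 1 : ℕ) : ℝ) * k - n * k = k := by push_cast; ring
  have hlast : ‖∫ s in (n * k : ℝ)..(n + 1 : ℕ) * k, v s‖ ≤ M * k := by
    have := intervalIntegral.norm_integral_le_of_norm_le_const (C := M)
      (a := n * k) (b := (n + 1 : ℕ) * k) (f := v) (by
        intro s hs
        rw [uIoc_of_le h1] at hs
        exact hM s ⟨h0.trans hs.1.le, hs.2.trans hj⟩)
    rwa [hlen, abs_of_nonneg hk] at this
  have hquad := hv.norm_integral_sub_sum_le hk n (h1.trans hj)
  have hquad' : n * (L * k * k) ≤ T * L * k := by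
    have := mul_le_mul_of_nonneg_right (h1.trans hj) (mul_nonneg L.2 hk)
    calc n * (L * k * k) = n * k * (L * k) := by ring
      _ ≤ T * (L * k) := this
      _ = T * L * k := by ring
  have hsum : ‖k • ∑ i ∈ Finset.Icc 1 n, (v (i * k) - y i)‖ ≤
      k * ∑ i ∈ Finset.Icc 1 n, ‖v (i * k) - y i‖ := by
    rw [norm_smul, Real.norm_of_nonneg hk]
    exact mul_le_mul_of_nonneg_left (norm_sum_le _ _) hk
  have hsplit : ((∫ s in (0 : ℝ)..(n + 1 : ℕ) * k, v s) + u₀) - Kk k u₁ y n =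
      ((∫ s in (0 : ℝ)..n * k, v s) - k • ∑ i ∈ Finset.Icc 1 n, v (i * k)) +
        (∫ s in (n * k : ℝ)..(n + 1 : ℕ) * k, v s) +
        k • ∑ i ∈ Finset.Icc 1 n, (v (i * k) - y i) + (u₀ - u₁) := by
    rw [← intervalIntegral.integral_add_adjacent_intervals hi1 hi2, Kk,
      Finset.sum_sub_distrib, smul_sub]
    abel
  rw [hsplit]
  refine (norm_add_le _ _).trans ?_
  gcongr
  refine (norm_add_le _ _).trans ?_
  gcongr
  refine (norm_add_le _ _).trans ?_
  linarith

theorem hvi_error_inequality {V X : Type*} [NormedAddCommGroup V] [NormedSpace ℝ V]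
    [NormedAddCommGroup X] [NormedSpace ℝ X]
    {γ : V →L[ℝ] X} {A : V →L[ℝ] V →L[ℝ] ℝ} {mA : ℝ} (hAco : ∀ u : V, mA * ‖u‖ ^ 2 ≤ A u u)
    {B : V → V →L[ℝ] ℝ} {LB : ℝ} (hLB : 0 ≤ LB) (hB : ∀ v w : V, ‖B v - B w‖ ≤ LB * ‖v - w‖)
    {J : X → X → ℝ} (hJa : ∀ w : X, LocallyLipschitz (J w))
    {c₀ c₁ c₂ : ℝ} (hc₁ : 0 ≤ c₁) (hc₂ : 0 ≤ c₂)
    (hJb : ∀ w v : X, ∀ ξ ∈ clarkeSubdiff (J w) v, ‖ξ‖ ≤ c₀ + c₁ * ‖w‖ + c₂ * ‖v‖)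
    {mJ1 mJ2 : ℝ} (hmJ1 : 0 ≤ mJ1) (hmJ2 : 0 ≤ mJ2)
    (hJc : ∀ w₁ w₂ v₁ v₂ : X,
      clarkeDeriv (J w₁) v₁ (v₂ - v₁) + clarkeDeriv (J w₂) v₂ (v₁ - v₂) ≤
        mJ1 * ‖v₁ - v₂‖ ^ 2 + mJ2 * ‖w₁ - w₂‖ * ‖v₁ - v₂‖)
    {g : V →L[ℝ] ℝ} {p q x y w : V} {M₁ M₂ : ℝ} (hp : ‖p‖ ≤ M₁) (hx : ‖x‖ ≤ M₂)
    (h₁ : g (y - x) ≤ A x (y - x) + B p (y - x) + clarkeDeriv (J (γ p)) (γ x) (γ (y - x)))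
    (h₂ : g (w - y) ≤ A y (w - y) + B q (w - y) + clarkeDeriv (J (γ q)) (γ y) (γ (w - y))) :
    (mA - mJ1 * ‖γ‖ ^ 2) * ‖x - y‖ ^ 2 ≤
      LB * ‖p - q‖ * (‖x - y‖ + ‖x - w‖) + |A x (x - w) + B p (x - w) - g (x - w)| +
        ‖A‖ * ‖x - y‖ * ‖x - w‖ + mJ2 * ‖γ‖ ^ 2 * ‖p - q‖ * ‖x - y‖ +
        ((c₀ + c₁ * ‖γ‖ * M₁ + c₂ * ‖γ‖ * M₂) + c₁ * ‖γ‖ * ‖p - q‖ + c₂ * ‖γ‖ * ‖x - y‖) *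
          ‖γ x - γ w‖ := by
  have hco := hAco (x - y)
  have hAe : A (x - y) (x - w) ≤ ‖A‖ * ‖x - y‖ * ‖x - w‖ :=
    (le_abs_self _).trans (A.le_opNorm₂ _ _)
  have hBe : (B q - B p) (w - y) ≤ LB * ‖p - q‖ * (‖x - y‖ + ‖x - w‖) := by
    refine (le_abs_self _).trans (((B q - B p).le_opNorm (w - y)).trans ?_)
    have h := hB q p
    rw [norm_sub_rev q p] at h
    have h' : ‖w - y‖ ≤ ‖x - y‖ + ‖x - w‖ := by
      have : w - y = (x - y) - (x - w) := by abel
      rw [this]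
      exact norm_sub_le _ _
    exact mul_le_mul h h' (norm_nonneg _) (by positivity)
  have hR := neg_abs_le (A x (x - w) + B p (x - w) - g (x - w))
  have hJsub : clarkeDeriv (J (γ q)) (γ y) (γ (w - y)) ≤
      clarkeDeriv (J (γ q)) (γ y) (γ x - γ y) + clarkeDeriv (J (γ q)) (γ y) (γ w - γ x) := by
    have h := (hJa (γ q)).clarkeDeriv_add_le (γ y) (γ x - γ y) (γ w - γ x)
    rwa [sub_add_sub_cancel', ← map_sub] at h
  have hJm := hJc (γ p) (γ q) (γ x) (γ y)
  rw [map_sub γ y x] at h₁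
  have hγe : ‖γ x - γ y‖ ≤ ‖γ‖ * ‖x - y‖ := by
    rw [← map_sub]; exact γ.le_opNorm _
  have hγp : ‖γ p - γ q‖ ≤ ‖γ‖ * ‖p - q‖ := by
    rw [← map_sub]; exact γ.le_opNorm _
  have hJm1 : mJ1 * ‖γ x - γ y‖ ^ 2 ≤ mJ1 * (‖γ‖ * ‖x - y‖) ^ 2 := by gcongr
  have hJm2 : mJ2 * ‖γ p - γ q‖ * ‖γ x - γ y‖ ≤
      mJ2 * (‖γ‖ * ‖p - q‖) * (‖γ‖ * ‖x - y‖) := by gcongr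
  have hγq : ‖γ q‖ ≤ ‖γ‖ * M₁ + ‖γ‖ * ‖p - q‖ := by
    have : ‖q‖ ≤ M₁ + ‖p - q‖ := by
      have := norm_sub_norm_le q p
      rw [norm_sub_rev] at this
      linarith
    exact (γ.le_opNorm_of_le this).trans (le_of_eq (by ring))
  have hγy : ‖γ y‖ ≤ ‖γ‖ * M₂ + ‖γ‖ * ‖x - y‖ := by
    have : ‖y‖ ≤ M₂ + ‖x - y‖ := by
      have := norm_sub_norm_le y x
      rw [norm_sub_rev] at this
      linarith
    exact (γ.le_opNorm_of_le this).trans (le_of_eq (by ring))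
  have hJd : clarkeDeriv (J (γ q)) (γ y) (γ w - γ x) ≤
      ((c₀ + c₁ * ‖γ‖ * M₁ + c₂ * ‖γ‖ * M₂) + c₁ * ‖γ‖ * ‖p - q‖ + c₂ * ‖γ‖ * ‖x - y‖) *
        ‖γ x - γ w‖ := by
    rw [norm_sub_rev (γ x)]
    refine (hJa (γ q)).clarkeDeriv_le_mul_norm (fun ξ hξ => (hJb _ _ ξ hξ).trans ?_) _
    have e1 := mul_le_mul_of_nonneg_left hγq hc₁
    have e2 := mul_le_mul_of_nonneg_left hγy hc₂
    linarith
  simp only [map_sub, _root_.sub_apply] at *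
  linarith

/-- Céa-type error estimate for the fully discrete scheme: the constant
`c` is independent of the subspace `V^h`, of `u₀^h`, of `k` and of `N`. The infimum over
`w^h ∈ V^h` is expressed by quantifying over arbitrary selections `w : ℕ → V^h`. -/
theorem error_estimate
    {V X : Type*}
    [NormedAddCommGroup V] [NormedSpace ℝ V] [CompleteSpace V]
    [NormedAddCommGroup X] [NormedSpace ℝ X] [CompleteSpace X]
    -- V reflexive
    (hrefl : Function.Surjective (NormedSpace.inclusionInDoubleDual ℝ V))
    (γ : V →L[ℝ] X)
    -- H(A)
    (A : V →L[ℝ] V →L[ℝ] ℝ)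
    (hAsym : ∀ u v : V, A u v = A v u)
    (mA : ℝ) (hmA : 0 < mA)
    (hAco : ∀ u : V, mA * ‖u‖ ^ 2 ≤ A u u)
    -- H(B)
    (B : V → V →L[ℝ] ℝ)
    (LB : ℝ) (hLB : 0 < LB)
    (hB : ∀ v w : V, ‖B v - B w‖ ≤ LB * ‖v - w‖)
    -- H(J)
    (J : X → X → ℝ)
    (hJa : ∀ w : X, LocallyLipschitz (J w))
    (c₀ c₁ c₂ : ℝ) (hc₀ : 0 ≤ c₀) (hc₁ : 0 ≤ c₁) (hc₂ : 0 ≤ c₂)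
    (hJb : ∀ w v : X, ∀ ξ ∈ clarkeSubdiff (J w) v, ‖ξ‖ ≤ c₀ + c₁ * ‖w‖ + c₂ * ‖v‖)
    (mJ1 mJ2 : ℝ) (hmJ1 : 0 ≤ mJ1) (hmJ2 : 0 ≤ mJ2)
    (hJc : ∀ w₁ w₂ v₁ v₂ : X,
      clarkeDeriv (J w₁) v₁ (v₂ - v₁) + clarkeDeriv (J w₂) v₂ (v₁ - v₂) ≤
        mJ1 * ‖v₁ - v₂‖ ^ 2 + mJ2 * ‖w₁ - w₂‖ * ‖v₁ - v₂‖)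
    -- H(f)
    (T : ℝ) (hT : 0 < T)
    (f : ℝ → V →L[ℝ] ℝ) (hf : ContinuousOn f (Set.Icc 0 T))
    -- H(u₀)
    (u₀ : V)
    -- (H_s)
    (hs : 0 < mA - 2 * mJ1 * ‖γ‖ ^ 2)
    -- v is a solution of Problem P_hvi
    (v : ℝ → V)
    (hvsol : ∀ t ∈ Set.Icc (0 : ℝ) T, ∀ w : V,
      f t w ≤ A (v t) w + B ((∫ s in (0 : ℝ)..t, v s) + u₀) w +
        clarkeDeriv (J (γ ((∫ s in (0 : ℝ)..t, v s) + u₀))) (γ (v t)) (γ w))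
    -- v ∈ W^{1,∞}(0,T;V): v is Lipschitz continuous on [0,T]
    (Lv : NNReal) (hvlip : LipschitzOnWith Lv v (Set.Icc 0 T)) :
    ∃ c : ℝ, 0 < c ∧
      ∀ (Vh : Submodule ℝ V), FiniteDimensional ℝ Vh → ∀ (u0h : Vh)
        (N : ℕ) (hN : 1 ≤ N) (vhk : ℕ → Vh),
        SolOpt γ A B J f Vh u0h (T / N) N vhk →
        ∀ w : ℕ → Vh, ∀ j ∈ Finset.Icc 1 N,
          ‖v ((j : ℝ) * (T / N)) - (vhk j : V)‖ ^ 2 ≤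
            c * (Finset.Icc 1 N).sup' (Finset.nonempty_Icc.mpr hN) (fun i =>
              (T / N) ^ 2 + ‖v ((i : ℝ) * (T / N)) - (w i : V)‖ ^ 2 +
              ‖γ (v ((i : ℝ) * (T / N))) - γ ((w i : V))‖ +
              |A (v ((i : ℝ) * (T / N))) (v ((i : ℝ) * (T / N)) - (w i : V)) +
                B ((∫ s in (0 : ℝ)..((i : ℝ) * (T / N)), v s) + u₀)
                  (v ((i : ℝ) * (T / N)) - (w i : V)) -
                f ((i : ℝ) * (T / N)) (v ((i : ℝ) * (T / N)) - (w i : V))|) +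
            c * ‖u₀ - (u0h : V)‖ ^ 2 := by
  set Γ := ‖γ‖ with hΓ
  set M := ‖v 0‖ + Lv * T with hM
  set M₁ := M * T + ‖u₀‖ with hM₁
  set m := mA - mJ1 * Γ ^ 2 with hm
  have hΓ0 : 0 ≤ Γ := norm_nonneg γ
  have hM0 : 0 ≤ M := by positivity
  have hM₁0 : 0 ≤ M₁ := by positivity
  have hm0 : 0 < m := by
    have : 0 ≤ mJ1 * Γ ^ 2 := by positivity
    linarith
  set P := c₀ + c₁ * Γ * M₁ + c₂ * Γ * M with hP
  have hP0 : 0 ≤ P := by positivity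
  set C := 2 / m * ((LB + mJ2 * Γ ^ 2) ^ 2 / m + (‖A‖ + c₂ * Γ * Γ) ^ 2 / m +
    (LB + c₁ * Γ * Γ) + 1 + P) with hC
  have hC0 : 0 < C := by positivity
  set D := T * Lv + M with hD
  have hD0 : 0 ≤ D := by positivity
  have hvM : ∀ t ∈ Icc 0 T, ‖v t‖ ≤ M := by
    intro t ht
    have h := hvlip.dist_le_mul t ht 0 ⟨le_rfl, hT.le⟩
    rw [dist_eq_norm, Real.dist_eq, sub_zero, abs_of_nonneg ht.1] at h
    have h1 := norm_sub_norm_le (v t) (v 0)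
    have h2 : Lv * t ≤ Lv * T := mul_le_mul_of_nonneg_left ht.2 Lv.2
    linarith
  have hKM : ∀ t ∈ Icc 0 T, ‖(∫ s in (0 : ℝ)..t, v s) + u₀‖ ≤ M₁ := by
    intro t ht
    have h := intervalIntegral.norm_integral_le_of_norm_le_const (C := M)
      (a := 0) (b := t) (f := v) (by
        intro s hs
        rw [uIoc_of_le ht.1] at hs
        exact hvM s ⟨hs.1.le, hs.2.trans ht.2⟩)
    rw [sub_zero, abs_of_nonneg ht.1] at h
    have h2 : M * t ≤ M * T := mul_le_mul_of_nonneg_left ht.2 hM0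
    exact (norm_add_le _ _).trans (by linarith)
  refine ⟨C * (3 * D ^ 2 + 3) * Real.exp (3 * C * T * T), by positivity, ?_⟩
  intro Vh _ u0h N hN vhk hsol w
  set k := T / N with hk
  have hNpos : (0 : ℝ) < N := by exact_mod_cast hN
  have hk0 : 0 ≤ k := by positivity
  have hNk : N * k = T := by rw [hk]; field_simp
  have hjk : ∀ j ∈ Finset.Icc 1 N, (j : ℝ) * k ≤ T := by
    intro j hj
    rw [← hNk]
    exact mul_le_mul_of_nonneg_right (by exact_mod_cast (Finset.mem_Icc.1 hj).2) hk0
  set F : ℕ → ℝ := fun i => k ^ 2 + ‖v ((i : ℝ) * k) - (w i : V)‖ ^ 2 +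
    ‖γ (v ((i : ℝ) * k)) - γ ((w i : V))‖ +
    |A (v ((i : ℝ) * k)) (v ((i : ℝ) * k) - (w i : V)) +
      B ((∫ s in (0 : ℝ)..((i : ℝ) * k), v s) + u₀) (v ((i : ℝ) * k) - (w i : V)) -
      f ((i : ℝ) * k) (v ((i : ℝ) * k) - (w i : V))| with hF
  set S := (Finset.Icc 1 N).sup' (Finset.nonempty_Icc.mpr hN) F with hS
  have hFS : ∀ j ∈ Finset.Icc 1 N, F j ≤ S := fun j hj => Finset.le_sup' F hj
  have hkS : k ^ 2 ≤ S := by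
    refine le_trans ?_ (hFS 1 (Finset.mem_Icc.2 ⟨le_rfl, hN⟩))
    simp only [hF, add_assoc]
    exact le_add_of_nonneg_right (by positivity)
  have hS0 : 0 ≤ S := (sq_nonneg k).trans hkS
  set U := ‖u₀ - (u0h : V)‖ with hU
  set a : ℕ → ℝ := fun i => ‖v ((i : ℝ) * k) - (vhk i : V)‖ ^ 2 with ha
  have hrec : ∀ j ∈ Finset.Icc 1 N, a j ≤ C * (3 * D ^ 2 + 3) * (S + U ^ 2) +
      3 * C * T * k * ∑ i ∈ Finset.Icc 1 (j - 1), a i := by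
    intro j hj
    obtain ⟨hj1, hjN⟩ := Finset.mem_Icc.1 hj
    have ht : (j : ℝ) * k ∈ Icc 0 T := ⟨by positivity, hjk j hj⟩
    have h₂ := hsol.hvi hAsym hJa hj (w j - vhk j)
    rw [Submodule.coe_sub] at h₂
    have herr := hvi_error_inequality hAco hLB.le hB hJa hc₁ hc₂ hJb hmJ1 hmJ2 hJc
      (hKM _ ht) (hvM _ ht) (hvsol _ ht (vhk j - v (j * k))) h₂
    have hγd : ‖γ (v (j * k)) - γ (w j)‖ ≤ Γ * ‖v (j * k) - w j‖ := by
      rw [← map_sub]; exact γ.le_opNorm _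
    have hsq := sq_le_of_quadratic_bound hm0 hLB.le hP0 (by positivity) (by positivity) hΓ0
      (norm_nonneg _) (norm_nonneg _) (norm_nonneg _) (abs_nonneg _) hγd herr
    have hcoe : ((Kk k u0h vhk (j - 1) : Vh) : V) =
        Kk k (u0h : V) (fun i => (vhk i : V)) (j - 1) := by
      simp [Kk]
    have hδ := hvlip.norm_integral_sub_Kk_le hk0 hvM u₀ (u0h : V) (fun i => (vhk i : V)) hj1
      (hjk j hj)
    rw [← hcoe] at hδ
    set δ := ‖(∫ s in (0 : ℝ)..j * k, v s) + u₀ - (Kk k u0h vhk (j - 1) : Vh)‖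
    set E := ∑ i ∈ Finset.Icc 1 (j - 1), ‖v (i * k) - vhk i‖ with hE
    have hE2 : (k * E) ^ 2 ≤ T * k * ∑ i ∈ Finset.Icc 1 (j - 1), a i := by
      have h1 : E ^ 2 ≤ ((j - 1 : ℕ) : ℝ) * ∑ i ∈ Finset.Icc 1 (j - 1), a i := by
        have := sq_sum_le_card_mul_sum_sq (s := Finset.Icc 1 (j - 1))
          (f := fun i => ‖v (i * k) - vhk i‖)
        simpa using this
      have h2 : ((j - 1 : ℕ) : ℝ) * k ≤ T := by
        refine le_trans ?_ (hjk j hj)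
        gcongr
        omega
      have h3 : 0 ≤ ∑ i ∈ Finset.Icc 1 (j - 1), a i :=
        Finset.sum_nonneg fun i _ => sq_nonneg _
      calc (k * E) ^ 2 = k ^ 2 * E ^ 2 := by ring
        _ ≤ k ^ 2 * (((j - 1 : ℕ) : ℝ) * ∑ i ∈ Finset.Icc 1 (j - 1), a i) := by gcongr
        _ = (((j - 1 : ℕ) : ℝ) * k) * k * ∑ i ∈ Finset.Icc 1 (j - 1), a i := by ring
        _ ≤ _ := by gcongr
    have hδ2 : δ ^ 2 ≤ 3 * (D ^ 2 * k ^ 2 + T * k * ∑ i ∈ Finset.Icc 1 (j - 1), a i + U ^ 2) := by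
      refine (sq_le_three_mul_add_sq (norm_nonneg _) hδ).trans ?_
      rw [mul_pow D k]
      gcongr
    have hFj := hFS j hj
    simp only [hF] at hFj
    have hDk : D ^ 2 * k ^ 2 ≤ D ^ 2 * S := by gcongr
    have hDU : 0 ≤ D ^ 2 * U ^ 2 := by positivity
    refine hsq.trans ?_
    calc _ ≤ C * ((3 * D ^ 2 + 3) * (S + U ^ 2) +
          3 * T * k * ∑ i ∈ Finset.Icc 1 (j - 1), a i) := by
          refine mul_le_mul_of_nonneg_left ?_ hC0.le
          linarith [sq_nonneg k]
      _ = _ := by ring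
  intro j hj
  have hgr := le_mul_exp_of_le_add_mul_sum (by positivity) (by positivity) hrec j hj
  have hexp : N * (3 * C * T * k) = 3 * C * T * T := by
    rw [mul_left_comm, hNk]
  rw [hexp] at hgr
  exact hgr.trans (le_of_eq (by ring))
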